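/- Let s ∈ (1,2) and let w : ℝⁿ → ℝ be a bounded Lipschitz function (with Lipschitz constant L and bound M) such that for all x in a set S ⊂ ℝⁿ and all y with |y| < r₀ one has |w(x+y)| ≤ C₀|y|². Fix x₀ with the same property. Then for all x ∈ S, |(-Δ)^{s/2}w(x) - (-Δ)^{s/2}w(x₀)| ≤ C|x - x₀|^{1 - s/2}, where C depends only on n, s, C₀, L, M, r₀, and (-Δ)^{s/2} is defined for s/2 ∈ (1/2, 1) by the principal value integral (-Δ)^{s/2}w(x) = c_{n,s/2} PV ∫ (w(x)-w(y))/|x-y|^{n+s} dy. -/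

import Mathlib

open MeasureTheory Filter

/-- Principal-value fractional Laplacian `(-Δ)^{s/2}` with normalization constant `c`,
defined as the limit as `ε → 0⁺` of the `ε`-truncated integrals
`c ∫_{|x-y|>ε} (w(x)-w(y))/|x-y|^{n+s} dy`. -/
noncomputable def pvHalfLap {n : ℕ} (c s : ℝ) (w : EuclideanSpace ℝ (Fin n) → ℝ)
    (x : EuclideanSpace ℝ (Fin n)) : ℝ :=
  limUnder (nhdsWithin 0 (Set.Ioi (0 : ℝ))) fun ε =>
    c * ∫ y in {y : EuclideanSpace ℝ (Fin n) | ε < ‖x - y‖},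
      (w x - w y) / ‖x - y‖ ^ ((n : ℝ) + s)

lemma aux_int1 (n : ℕ) (hn : 1 ≤ n) (s : ℝ) (hs : s ∈ Set.Ioo (1 : ℝ) 2) (a b : ℝ)
    (ha : 0 < a) (hb : 0 < b) :
    Integrable (fun y : EuclideanSpace ℝ (Fin n) =>
      min (a * ‖y‖ ^ 2) b / ‖y‖ ^ ((n : ℝ) + s)) := by
  obtain ⟨hs1, hs2⟩ := hs
  haveI : Nonempty (Fin n) := ⟨⟨0, hn⟩⟩
  have key := integrable_fun_norm_addHaar (E := EuclideanSpace ℝ (Fin n)) volume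
    (f := fun t : ℝ => min (a * t ^ 2) b / t ^ ((n : ℝ) + s))
  rw [key]
  have hdim : Module.finrank ℝ (EuclideanSpace ℝ (Fin n)) = n := by simp
  rw [hdim]
  have hmeas : Measurable (fun t : ℝ => t ^ (n - 1) • (min (a * t ^ 2) b / t ^ ((n : ℝ) + s))) := by
    simp only [smul_eq_mul]
    fun_prop
  have hpow : ∀ t : ℝ, 0 < t → t ^ (n - 1) = t ^ ((n : ℝ) - 1) := by
    intro t ht
    rw [← Real.rpow_natCast, Nat.cast_sub hn, Nat.cast_one]
  rw [← Set.Ioc_union_Ioi_eq_Ioi (zero_le_one (α := ℝ))]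
  refine IntegrableOn.union ?_ ?_
  · have h1 : IntegrableOn (fun t : ℝ => a * t ^ (1 - s)) (Set.Ioc 0 1) := by
      have := intervalIntegral.intervalIntegrable_rpow' (a := 0) (b := 1) (r := 1 - s) (by linarith)
      rw [intervalIntegrable_iff_integrableOn_Ioc_of_le zero_le_one] at this
      exact this.const_mul a
    refine Integrable.mono' h1 hmeas.aestronglyMeasurable ?_
    refine (ae_restrict_iff' measurableSet_Ioc).2 (Eventually.of_forall fun t ht => ?_)
    have ht0 : 0 < t := ht.1
    rw [Real.norm_of_nonneg (by rw [smul_eq_mul]; positivity), smul_eq_mul, hpow t ht0]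
    calc t ^ ((n : ℝ) - 1) * (min (a * t ^ 2) b / t ^ ((n : ℝ) + s))
        ≤ t ^ ((n : ℝ) - 1) * ((a * t ^ 2) / t ^ ((n : ℝ) + s)) := by
          gcongr; exact min_le_left _ _
      _ = a * (t ^ ((n : ℝ) - 1) * t ^ (2 : ℝ) / t ^ ((n : ℝ) + s)) := by
          rw [Real.rpow_two]; ring
      _ = a * t ^ (1 - s) := by
          rw [← Real.rpow_add ht0, ← Real.rpow_sub ht0]; congr 2; ring
  · have h1 : IntegrableOn (fun t : ℝ => b * t ^ (-1 - s)) (Set.Ioi 1) :=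
      (integrableOn_Ioi_rpow_of_lt (by linarith) zero_lt_one).const_mul b
    refine Integrable.mono' h1 hmeas.aestronglyMeasurable ?_
    refine (ae_restrict_iff' measurableSet_Ioi).2 (Eventually.of_forall fun t ht => ?_)
    have ht0 : 0 < t := lt_trans zero_lt_one ht
    rw [Real.norm_of_nonneg (by rw [smul_eq_mul]; positivity), smul_eq_mul, hpow t ht0]
    calc t ^ ((n : ℝ) - 1) * (min (a * t ^ 2) b / t ^ ((n : ℝ) + s))
        ≤ t ^ ((n : ℝ) - 1) * (b / t ^ ((n : ℝ) + s)) := by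
          gcongr; exact min_le_right _ _
      _ = b * (t ^ ((n : ℝ) - 1) / t ^ ((n : ℝ) + s)) := by ring
      _ = b * t ^ (-1 - s) := by
          rw [← Real.rpow_sub ht0]; congr 2; ring

lemma aux_scale (n : ℕ) (s : ℝ) (a b d : ℝ) (hd : 0 < d) :
    ∫ y : EuclideanSpace ℝ (Fin n), min (a * ‖y‖ ^ 2) (b * d) / ‖y‖ ^ ((n : ℝ) + s)
      = d ^ (1 - s / 2) *
        ∫ y : EuclideanSpace ℝ (Fin n), min (a * ‖y‖ ^ 2) b / ‖y‖ ^ ((n : ℝ) + s) := by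
  set r := d ^ (1 / 2 : ℝ) with hr
  have hr0 : 0 < r := Real.rpow_pos_of_pos hd _
  have hrr : r ^ 2 = d := by
    rw [← Real.rpow_natCast, hr, ← Real.rpow_mul hd.le]; norm_num
  have h := Measure.integral_comp_smul (volume : Measure (EuclideanSpace ℝ (Fin n)))
    (fun y => min (a * ‖y‖ ^ 2) (b * d) / ‖y‖ ^ ((n : ℝ) + s)) r
  have hdim : Module.finrank ℝ (EuclideanSpace ℝ (Fin n)) = n := by simp
  rw [hdim, abs_of_pos (by positivity), smul_eq_mul] at h
  have h2 : ∀ y : EuclideanSpace ℝ (Fin n),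
      min (a * ‖r • y‖ ^ 2) (b * d) / ‖r • y‖ ^ ((n : ℝ) + s)
      = (d / r ^ ((n : ℝ) + s)) * (min (a * ‖y‖ ^ 2) b / ‖y‖ ^ ((n : ℝ) + s)) := by
    intro y
    rw [norm_smul, Real.norm_of_nonneg hr0.le, Real.mul_rpow hr0.le (norm_nonneg _), mul_pow, hrr,
      show a * (d * ‖y‖ ^ 2) = (a * ‖y‖ ^ 2) * d by ring, ← min_mul_of_nonneg _ _ hd.le]
    ring
  simp only [h2] at h
  rw [integral_const_mul] at h
  have h3 : ∀ I : ℝ, I = r ^ n * ((r ^ n)⁻¹ * I) := by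
    intro I
    have : r ^ n ≠ 0 := by positivity
    field_simp
  rw [h3 (∫ y : EuclideanSpace ℝ (Fin n), min (a * ‖y‖ ^ 2) (b * d) / ‖y‖ ^ ((n : ℝ) + s)), ← h,
    ← mul_assoc]
  congr 1
  have e1 : r ^ n * (d / r ^ ((n : ℝ) + s)) = d / r ^ s := by
    rw [Real.rpow_add hr0, Real.rpow_natCast]
    have : r ^ n ≠ 0 := by positivity
    field_simp
  rw [e1, hr, ← Real.rpow_mul hd.le, Real.rpow_sub hd, Real.rpow_one]
  congr 2; ring

lemma aux_pv (n : ℕ) (hn : 1 ≤ n) (s : ℝ) (hs : s ∈ Set.Ioo (1 : ℝ) 2) (c a M : ℝ)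
    (ha : 0 < a) (hM : 0 < M) (w : EuclideanSpace ℝ (Fin n) → ℝ) (hw : Continuous w)
    (x : EuclideanSpace ℝ (Fin n)) (h1 : ∀ y, |w (x + y)| ≤ a * ‖y‖ ^ 2)
    (h2 : ∀ y, |w y| ≤ M) :
    Integrable (fun y => w (x + y) / ‖y‖ ^ ((n : ℝ) + s)) ∧
    pvHalfLap c s w x = - (c * ∫ y, w (x + y) / ‖y‖ ^ ((n : ℝ) + s)) := by
  have hwx : w x = 0 := by simpa using h1 0
  have hi : Integrable (fun y => w (x + y) / ‖y‖ ^ ((n : ℝ) + s)) := by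
    refine Integrable.mono' (aux_int1 n hn s hs a M ha hM) ?_ (Eventually.of_forall fun y => ?_)
    · have := hw.measurable
      apply Measurable.aestronglyMeasurable
      fun_prop
    · rw [norm_div, Real.norm_of_nonneg (by positivity : 0 ≤ ‖y‖ ^ ((n : ℝ) + s)),
        Real.norm_eq_abs]
      gcongr
      exact le_min (h1 y) (h2 _)
  refine ⟨hi, ?_⟩
  set F : EuclideanSpace ℝ (Fin n) → ℝ := fun y => (w x - w y) / ‖x - y‖ ^ ((n : ℝ) + s) with hF
  have hFx : (fun y => F (x + y)) = fun y => - (w (x + y) / ‖y‖ ^ ((n : ℝ) + s)) := by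
    funext y
    simp [hF, hwx, neg_div]
  have hFi : Integrable F := by
    have : Integrable (fun y => F (x + y)) := by rw [hFx]; exact hi.neg
    have := this.comp_add_left (-x)
    simpa using this
  have hFint : ∫ y, F y = - ∫ y, w (x + y) / ‖y‖ ^ ((n : ℝ) + s) := by
    rw [← integral_add_left_eq_self F x, hFx, integral_neg]
  have hms : ∀ ε : ℝ, MeasurableSet {y : EuclideanSpace ℝ (Fin n) | ε < ‖x - y‖} := fun ε =>
    measurableSet_lt measurable_const (by fun_prop)
  have ht : Tendsto (fun ε : ℝ => ∫ y in {y : EuclideanSpace ℝ (Fin n) | ε < ‖x - y‖}, F y)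
      (nhdsWithin 0 (Set.Ioi (0 : ℝ))) (nhds (∫ y, F y)) := by
    simp_rw [← integral_indicator (hms _)]
    refine tendsto_integral_filter_of_dominated_convergence (fun y => ‖F y‖)
      (Eventually.of_forall fun ε => hFi.aestronglyMeasurable.indicator (hms ε))
      (Eventually.of_forall fun ε => Eventually.of_forall fun y => norm_indicator_le_norm_self _ _)
      hFi.norm (Eventually.of_forall fun y => ?_)
    by_cases hxy : y = x
    · have h0 : F y = 0 := by simp [hF, hxy]
      have : (fun ε : ℝ => Set.indicator {y : EuclideanSpace ℝ (Fin n) | ε < ‖x - y‖} F y)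
          = fun _ => F y := by
        funext ε
        by_cases h : ε < ‖x - y‖ <;> simp [Set.indicator, h0]
      rw [this]; exact tendsto_const_nhds
    · have hpos : 0 < ‖x - y‖ := norm_pos_iff.2 (sub_ne_zero.2 (Ne.symm hxy))
      refine tendsto_const_nhds.congr' ?_
      filter_upwards [nhdsWithin_le_nhds (Iio_mem_nhds hpos)] with ε hε
      rw [Set.indicator_of_mem]
      exact hε
  have := (ht.const_mul c).limUnder_eq
  rw [pvHalfLap, this, hFint]
  ring

theorem stmt19 (n : ℕ) (hn : 1 ≤ n) (s : ℝ) (hs : s ∈ Set.Ioo (1 : ℝ) 2)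
    (c : ℝ) (hc : 0 < c) (C₀ L M r₀ : ℝ) (hC₀ : 0 < C₀) (hL : 0 < L) (hM : 0 < M)
    (hr₀ : 0 < r₀) :
    ∃ C : ℝ, 0 < C ∧
      ∀ (w : EuclideanSpace ℝ (Fin n) → ℝ) (S : Set (EuclideanSpace ℝ (Fin n)))
        (x₀ : EuclideanSpace ℝ (Fin n)),
        LipschitzWith (Real.toNNReal L) w →
        (∀ x, |w x| ≤ M) →
        (∀ x ∈ S, ∀ y : EuclideanSpace ℝ (Fin n), ‖y‖ < r₀ → |w (x + y)| ≤ C₀ * ‖y‖ ^ 2) →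
        (∀ y : EuclideanSpace ℝ (Fin n), ‖y‖ < r₀ → |w (x₀ + y)| ≤ C₀ * ‖y‖ ^ 2) →
        ∀ x ∈ S,
          |pvHalfLap c s w x - pvHalfLap c s w x₀| ≤ C * ‖x - x₀‖ ^ (1 - s / 2) := by
  set a := C₀ + M / r₀ ^ 2 with ha
  have ha0 : 0 < a := by positivity
  set K := ∫ y : EuclideanSpace ℝ (Fin n), min (2 * a * ‖y‖ ^ 2) L / ‖y‖ ^ ((n : ℝ) + s) with hK
  have hK0 : 0 ≤ K := integral_nonneg fun y => by positivity
  refine ⟨c * K + 1, by positivity, ?_⟩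
  intro w S x₀ hw hb hS hx₀ x hx
  have ext : ∀ z : EuclideanSpace ℝ (Fin n),
      (∀ y : EuclideanSpace ℝ (Fin n), ‖y‖ < r₀ → |w (z + y)| ≤ C₀ * ‖y‖ ^ 2) →
      ∀ y, |w (z + y)| ≤ a * ‖y‖ ^ 2 := by
    intro z hz y
    rw [ha, add_mul]
    rcases lt_or_ge ‖y‖ r₀ with h | h
    · have := hz y h
      have : 0 ≤ M / r₀ ^ 2 * ‖y‖ ^ 2 := by positivity
      linarith [hz y h]
    · have h3 : M ≤ M / r₀ ^ 2 * ‖y‖ ^ 2 := by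
        rw [div_mul_eq_mul_div, le_div_iff₀ (by positivity)]
        gcongr
      have : 0 ≤ C₀ * ‖y‖ ^ 2 := by positivity
      linarith [hb (z + y)]
  have q1 := ext x (hS x hx)
  have q0 := ext x₀ hx₀
  obtain ⟨i1, e1⟩ := aux_pv n hn s hs c a M ha0 hM w hw.continuous x q1 hb
  obtain ⟨i0, e0⟩ := aux_pv n hn s hs c a M ha0 hM w hw.continuous x₀ q0 hb
  rcases eq_or_ne x x₀ with rfl | hne
  · simp only [sub_self, abs_zero]
    positivity
  have hd : 0 < ‖x - x₀‖ := norm_pos_iff.2 (sub_ne_zero.2 hne)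
  set d := ‖x - x₀‖ with hdd
  have main : ‖∫ y, (w (x + y) / ‖y‖ ^ ((n : ℝ) + s) - w (x₀ + y) / ‖y‖ ^ ((n : ℝ) + s))‖
      ≤ d ^ (1 - s / 2) * K := by
    rw [hK, ← aux_scale n s (2 * a) L d hd]
    refine norm_integral_le_of_norm_le
      (aux_int1 n hn s hs (2 * a) (L * d) (by positivity) (by positivity))
      (Eventually.of_forall fun y => ?_)
    rw [← sub_div, norm_div, Real.norm_of_nonneg (by positivity : 0 ≤ ‖y‖ ^ ((n : ℝ) + s)),
        Real.norm_eq_abs]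
    gcongr
    refine le_min ?_ ?_
    · have := abs_sub (w (x + y)) (w (x₀ + y))
      linarith [q1 y, q0 y]
    · have := hw.dist_le_mul (x + y) (x₀ + y)
      rw [Real.coe_toNNReal _ hL.le, Real.dist_eq, dist_add_right, dist_eq_norm] at this
      exact this
  rw [integral_sub i1 i0, Real.norm_eq_abs] at main
  rw [e1, e0, neg_sub_neg, ← mul_sub, abs_mul, abs_of_pos hc, abs_sub_comm]
  have hp : 0 ≤ d ^ (1 - s / 2) := by positivity
  nlinarith [mul_le_mul_of_nonneg_left main hc.le]
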